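/- Let a, b ∈ ℤ and n ≥ 1. The coefficient of y^{a+b−4} x_1 x_2 ⋯ x_n in L_0^{a,b}(y,x_1,…,x_n) equals (−1)^b n! C(a+b+n−3, n), which equals (−1)^b (a+b+n−3)!/(a+b−3)! whenever a+b ≥ 3. -/

import Mathlib

open MvPolynomial Finset

noncomputable section

/-- The polynomial ring `ℚ[x_1,…,x_n]`. -/
abbrev R (n : ℕ) : Type := MvPolynomial (Fin n) ℚ

/-- The field of rational functions `ℚ(x_1,…,x_n)`. -/
abbrev K (n : ℕ) : Type := FractionRing (R n)

/-- `x_1 + ⋯ + x_n` as an element of `K n`. -/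
def SX (n : ℕ) : K n := algebraMap (R n) (K n) (∑ j, X j)

/-- `x_1^3 + ⋯ + x_n^3` as an element of `K n`. -/
def SX3 (n : ℕ) : K n := algebraMap (R n) (K n) (∑ j, (X j)^3)

/-- `Δ(x_1,…,x_n) = ((Σ x_j)^3 − Σ x_j^3)/3`. -/
def Dlt (n : ℕ) : K n := ((SX n)^3 - SX3 n) / 3

/-- The ring homomorphism `ℚ[x_1,…,x_{|I|}] → ℚ(x_1,…,x_n)` substituting the variables
of the subset `I` (in increasing order). -/
def embRH {n : ℕ} (I : Finset (Fin n)) : R I.card →+* K n :=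
  (algebraMap (R n) (K n)).comp
    (MvPolynomial.rename (fun i : Fin I.card => ((I.orderIsoOfFin rfl) i : Fin n))).toRingHom

lemma embRH_inj {n : ℕ} (I : Finset (Fin n)) : Function.Injective (embRH I) := by
  have h1 : Function.Injective (fun i : Fin I.card => ((I.orderIsoOfFin rfl) i : Fin n)) := by
    intro i j hij
    exact (I.orderIsoOfFin rfl).injective (Subtype.val_injective hij)
  have h2 := (IsFractionRing.injective (R n) (K n)).comp (MvPolynomial.rename_injective _ h1)
  simpa [embRH, RingHom.coe_comp] using h2

/-- The field embedding `ℚ(x_1,…,x_{|I|}) → ℚ(x_1,…,x_n)` substituting the variables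
of the subset `I` (in increasing order).  Used for expressions like `G_{r'}(x_I)`. -/
def emb {n : ℕ} (I : Finset (Fin n)) : K I.card →+* K n :=
  IsFractionRing.lift (embRH_inj I)

/-- The normalized `n`-point functions `G_g(x_1,…,x_n)`, defined with a fuel parameter
(first argument) for structural recursion; for `fuel ≥ n` this computes the recursively
defined normalized `n`-point function:  `G_0(x) = x^{-2}`, `G_g(x) = 0` for `g ≥ 1`, and
for `n ≥ 2`,
`G_g = Σ_{r+s=g} ((2r+n−3)!!/(4^s(2r+2s+n−1)!!)) P_r Δ^s` where
`P_r = (1/(2Σx_j)) Σ_{I⊔J={1..n}, I,J≠∅} (Σ_I x)²(Σ_J x)² Σ_{r'≤r} G_{r'}(x_I)G_{r−r'}(x_J)`. -/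
def Gf : (fuel : ℕ) → (n : ℕ) → ℕ → K n
  | _, 0, _ => 0
  | _, 1, 0 => (algebraMap (R 1) (K 1) (X 0)) ^ (-2 : ℤ)
  | _, 1, _+1 => 0
  | 0, _+2, _ => 0
  | fuel+1, n+2, g =>
      ∑ s ∈ Finset.range (g+1),
        (((Nat.doubleFactorial (2*(g-s)+(n+2)-3) : ℚ) /
          (4^s * (Nat.doubleFactorial (2*g+(n+2)-1) : ℚ))) : K (n+2)) *
        ((2 * SX (n+2))⁻¹ *
          ∑ I : Finset (Fin (n+2)),
            if I ≠ ∅ ∧ I ≠ univ then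
              (algebraMap (R (n+2)) (K (n+2)) (∑ i ∈ I, X i))^2 *
              (algebraMap (R (n+2)) (K (n+2)) (∑ i ∈ Iᶜ, X i))^2 *
              ∑ r' ∈ Finset.range ((g-s)+1),
                emb I (Gf fuel I.card r') * emb Iᶜ (Gf fuel Iᶜ.card ((g-s) - r'))
            else 0) *
        (Dlt (n+2))^s

/-- The normalized `n`-point function `G_g(x_1,…,x_n)` as an element of `ℚ(x_1,…,x_n)`. -/
def Gnpt (n g : ℕ) : K n := Gf n n g

/-- `P_r(x_1,…,x_n)`. -/
def Ppoly (n r : ℕ) : K n :=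
  (2 * SX n)⁻¹ *
    ∑ I : Finset (Fin n),
      if I ≠ ∅ ∧ I ≠ univ then
        (algebraMap (R n) (K n) (∑ i ∈ I, X i))^2 *
        (algebraMap (R n) (K n) (∑ i ∈ Iᶜ, X i))^2 *
        ∑ r' ∈ Finset.range (r+1), emb I (Gnpt I.card r') * emb Iᶜ (Gnpt Iᶜ.card (r - r'))
      else 0

/-- The `n`-point function `F_g(x_1,…,x_n) = Σ_{h+d=g} (1/d!)((Σx_j^3)/24)^d G_h(x_1,…,x_n)`. -/
def Fnpt (n g : ℕ) : K n :=
  ∑ d ∈ Finset.range (g+1),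
    ((1 / (Nat.factorial d : ℚ)) : K n) * (SX3 n / 24)^d * Gnpt n (g-d)

open Classical in
/-- The coefficient of the monomial `Π x_j^{d_j}` of an element of `ℚ(x_1,…,x_n)` which is
a polynomial (junk value `0` otherwise). -/
def coeffK {n : ℕ} (f : K n) (d : Fin n → ℕ) : ℚ :=
  if h : ∃ p : R n, algebraMap (R n) (K n) p = f then
    MvPolynomial.coeff (Finsupp.equivFunOnFinite.symm d) h.choose
  else 0

/-- The intersection index `⟨τ_{d_1} ⋯ τ_{d_n}⟩_g`, i.e. the coefficient of `Π x_j^{d_j}`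
in `F_g(x_1,…,x_n)`.  For `(g,n) = (0,1), (0,2)` and nonnegative `d_j` the value is `0`
(the conventional values `⟨τ_{-2}⟩_0 = 1`, `⟨τ_k τ_{-1-k}⟩_0 = (-1)^k` have a negative index). -/
def bracket (g : ℕ) {n : ℕ} (d : Fin n → ℕ) : ℚ :=
  if g = 0 ∧ n ≤ 2 then 0 else coeffK (Fnpt n g) d

/-- `⟨τ_j Π_{i ∈ I} τ_{d_i}⟩_g` for a subset `I ⊆ {1,…,n}`. -/
def bracketI (g : ℕ) {n : ℕ} (j : ℕ) (I : Finset (Fin n)) (d : Fin n → ℕ) : ℚ :=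
  bracket g (Fin.cons j (fun i : Fin I.card => d ((I.orderIsoOfFin rfl) i)))


/-! ### Laurent expansions in `y` (formal series in `ℚ[x_1,…,x_n][[y,y⁻¹]]` of bounded
`y`-degree, realized as Hahn/Laurent series in the variable `t = y⁻¹`, so that the
coefficient of `y^k` is the Hahn coefficient at `-k`). -/

/-- Laurent series in `t = y⁻¹` with coefficients in `ℚ[x_1,…,x_n]`. -/
abbrev Lau (n : ℕ) : Type := LaurentSeries (R n)

/-- The generalized binomial coefficient `C(p,k) = p(p−1)⋯(p−k+1)/k!` for `p : ℤ`, `k : ℕ`. -/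
def binomZ (p : ℤ) (k : ℕ) : ℚ := (∏ i ∈ Finset.range k, ((p : ℚ) - i)) / (Nat.factorial k)

/-- The expansion of `(y + c)^m = Σ_{k≥0} C(m,k) c^k y^{m−k}` as a Laurent series
in `t = y⁻¹` (for `m ≥ 0` this is the usual binomial expansion of the polynomial). -/
def yExpAdd {n : ℕ} (c : R n) (m : ℤ) : Lau n :=
  (HahnSeries.single (-m) (1 : R n)) *
    HahnSeries.ofPowerSeries ℤ (R n)
      (PowerSeries.mk fun k => MvPolynomial.C (binomZ m k) * c^k)

/-- The expansion of `(±y + c)^m`, where the sign is `+` if `σ = true` and `−` otherwise;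
it is computed as `(±1)^m (y ± c)^m`. -/
def LExp {n : ℕ} (σ : Bool) (c : R n) (m : ℤ) : Lau n :=
  (if σ then 1 else if Even m then 1 else -1 : Lau n) *
    yExpAdd ((if σ then 1 else -1 : R n) * c) m

open Classical in
/-- The polynomial representing an element of `ℚ(x_1,…,x_n)` lying in `ℚ[x_1,…,x_n]`
(junk value `0` otherwise). -/
def polyOf {n : ℕ} (f : K n) : R n :=
  if h : ∃ p : R n, algebraMap (R n) (K n) p = f then h.choose else 0

/-- `±y` as a Laurent series in `t = y⁻¹`. -/
def yLau (n : ℕ) (σ : Bool) : Lau n :=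
  (if σ then 1 else -1 : Lau n) * HahnSeries.single (-1 : ℤ) (1 : R n)

/-- The expansion of `F_g(±y, x_I)` as a Laurent series in `t = y⁻¹` with coefficients in
`ℚ[x_1,…,x_n]`: for `(g,|I|+1) = (0,1)` it is `(±y)^{-2} = y^{-2}`, for `(g,|I|+1) = (0,2)`
it is `1/(±y + x_i) = Σ_{k≥0} (−1)^k x_i^k (±y)^{−k−1}`, and otherwise it is obtained by
substituting `±y` and the variables of `I` into the polynomial `F_g`. -/
def FExp {n : ℕ} (σ : Bool) (g : ℕ) (I : Finset (Fin n)) : Lau n :=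
  if g = 0 ∧ I.card = 0 then HahnSeries.single (2 : ℤ) (1 : R n)
  else if g = 0 ∧ I.card = 1 then LExp σ (∑ i ∈ I, X i) (-1)
  else
    MvPolynomial.eval₂ ((HahnSeries.C).comp (algebraMap ℚ (R n)))
      (Fin.cons (yLau n σ)
        (fun i : Fin I.card => HahnSeries.C (X ((I.orderIsoOfFin rfl) i : Fin n))))
      (polyOf (Fnpt (I.card + 1) g))

/-- `L_g^{a,b}(y, x_1,…,x_n) = Σ_{g'=0}^{g} Σ_{I⊔J={1,…,n}} (y+Σ_I x)^a (−y+Σ_J x)^b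
F_{g'}(y,x_I) F_{g−g'}(−y,x_J)` as a Laurent series in `t = y⁻¹`. -/
def LL (g n : ℕ) (a b : ℤ) : Lau n :=
  ∑ gp ∈ Finset.range (g+1), ∑ I : Finset (Fin n),
    LExp true (∑ i ∈ I, X i) a * LExp false (∑ i ∈ Iᶜ, X i) b *
      FExp true gp I * FExp false (g - gp) Iᶜ

/-- The coefficient of `y^k Π_j x_j^{d_j}` in a Laurent series in `t = y⁻¹` with coefficients
in `ℚ[x_1,…,x_n]`. -/
def coeffL {n : ℕ} (f : Lau n) (k : ℤ) (d : Fin n → ℕ) : ℚ :=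
  MvPolynomial.coeff (Finsupp.equivFunOnFinite.symm d) (f.coeff (-k))

/-- The index of the variable `z_i` among the `a + b + n` variables `z, w, x`. -/
def zIdx (a b n : ℕ) (i : Fin a) : Fin (a+b+n) := ⟨i.1, by have := i.2; omega⟩

/-- The index of the variable `w_i` among the `a + b + n` variables `z, w, x`. -/
def wIdx (a b n : ℕ) (i : Fin b) : Fin (a+b+n) := ⟨a + i.1, by have := i.2; omega⟩

/-- The index of the variable `x_i` among the `a + b + n` variables `z, w, x`. -/
def xIdx (a b n : ℕ) (i : Fin n) : Fin (a+b+n) := ⟨a + b + i.1, by have := i.2; omega⟩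

/-- `L_g(y; z_1,…,z_a; w_1,…,w_b; x_1,…,x_n)
 = Σ_{g'=0}^{g} Σ_{I⊔J={1,…,n}} F_{g'}(y, z, x_I) F_{g−g'}(−y, w, x_J)`,
as a Laurent series in `t = y⁻¹` with coefficients in `ℚ[z,w,x]`. -/
def LLm (g n a b : ℕ) : Lau (a+b+n) :=
  ∑ gp ∈ Finset.range (g+1), ∑ I : Finset (Fin n),
    FExp true gp ((univ.image (zIdx a b n)) ∪ I.image (xIdx a b n)) *
    FExp false (g - gp) ((univ.image (wIdx a b n)) ∪ Iᶜ.image (xIdx a b n))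

/-- The exponent vector of the monomial `Π z_j^{r_j} Π w_j^{s_j} Π x_j^{d_j}`. -/
def expVec (a b n : ℕ) (r : Fin a → ℕ) (s : Fin b → ℕ) (d : Fin n → ℕ) :
    Fin (a+b+n) → ℕ :=
  fun v =>
    if h : v.1 < a then r ⟨v.1, h⟩
    else if h2 : v.1 < a + b then s ⟨v.1 - a, by omega⟩
    else d ⟨v.1 - (a+b), by have := v.2; omega⟩


/-- The `|s|`-th finite difference of a polynomial of degree `m < |s|` vanishes. -/
lemma sum_powerset_neg_one_pow_mul_add_sum_pow {ι A : Type*} [DecidableEq ι] [CommRing A]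
    (f : ι → A) (s : Finset ι) :
    ∀ (m : ℕ), m < #s → ∀ y : A, ∑ I ∈ s.powerset, (-1) ^ #I * (y + ∑ i ∈ I, f i) ^ m = 0 := by
  induction s using Finset.induction_on with
  | empty => simp
  | insert a s ha ih =>
    intro m hm y
    rw [card_insert_of_notMem ha] at hm
    rw [sum_powerset_insert ha, ← sum_add_distrib]
    have key : ∀ I ∈ s.powerset, (-1) ^ #I * (y + ∑ i ∈ I, f i) ^ m +
        (-1) ^ #(insert a I) * (y + ∑ i ∈ insert a I, f i) ^ m =
        ∑ k ∈ range m, -(f a ^ (m - k) * m.choose k) *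
          ((-1) ^ #I * (y + ∑ i ∈ I, f i) ^ k) := by
      intro I hI
      have haI : a ∉ I := fun h => ha (mem_powerset.1 hI h)
      rw [card_insert_of_notMem haI, sum_insert haI, add_comm (f a), ← add_assoc,
        add_pow _ (f a), sum_range_succ, pow_succ, Nat.sub_self, Nat.choose_self, mul_add, mul_sum]
      have : ∀ k, -(f a ^ (m - k) * (m.choose k : A)) * ((-1) ^ #I * (y + ∑ i ∈ I, f i) ^ k) =
        (-1) ^ #I * -1 * ((y + ∑ i ∈ I, f i) ^ k * f a ^ (m - k) * m.choose k) := fun k => by ring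
      simp only [this]
      simp
    rw [sum_congr rfl key, sum_comm]
    refine sum_eq_zero fun k hk => ?_
    rw [← mul_sum, ih k (by have := mem_range.1 hk; omega), mul_zero]

/-- A specialization of Hurwitz's generalization of Abel's binomial identity. -/
lemma sum_powerset_nonempty_sum_pow_mul_sum_pow {ι A : Type*} [DecidableEq ι] [CommRing A]
    (f : ι → A) (s : Finset ι) :
    ∑ I ∈ s.powerset with I.Nonempty, (∑ i ∈ I, f i) ^ (#I - 1) * (∑ i ∈ s \ I, f i) ^ #(s \ I) =
      #s * (∑ i ∈ s, f i) ^ (#s - 1) := by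
  set S := ∑ i ∈ s, f i with hS
  have expand : ∀ I ∈ s.powerset.filter (·.Nonempty),
      (∑ i ∈ I, f i) ^ (#I - 1) * (∑ i ∈ s \ I, f i) ^ #(s \ I) =
      ∑ L ∈ (s \ I).powerset, S ^ #L *
        ((-1) ^ (#(s \ L) - #I) * (∑ i ∈ I, f i) ^ (#(s \ L) - 1)) := by
    intro I hI
    obtain ⟨hIs, hI⟩ := by simpa using hI
    have h1 : ∑ i ∈ s \ I, f i = S + -(∑ i ∈ I, f i) := by
      rw [hS, ← sum_sdiff hIs]; ring
    rw [h1, ← sum_pow_mul_eq_add_pow, mul_sum]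
    refine sum_congr rfl fun L hL => ?_
    have hL := mem_powerset.1 hL
    have hLs := hL.trans sdiff_subset
    have c1 := card_le_card hL
    have c2 := card_sdiff_of_subset hIs
    have c3 := card_sdiff_of_subset hLs
    have c4 := card_le_card hIs
    have c5 := hI.card_pos
    rw [show #(s \ L) - 1 = (#I - 1) + (#(s \ I) - #L) by omega,
      show #(s \ L) - #I = #(s \ I) - #L by omega, neg_pow]
    ring
  rw [sum_congr rfl expand, sum_comm' (t' := s.powerset)
    (s' := fun L => (s \ L).powerset.filter (·.Nonempty))]
  swap
  · intro I L
    simp only [mem_filter, mem_powerset, subset_sdiff, disjoint_comm]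
    tauto
  have inner : ∀ L ∈ s.powerset, ∑ I ∈ (s \ L).powerset with I.Nonempty, S ^ #L *
        ((-1) ^ (#(s \ L) - #I) * (∑ i ∈ I, f i) ^ (#(s \ L) - 1)) =
      if #(s \ L) = 1 then S ^ (#s - 1) else 0 := by
    intro L hL
    have hL := mem_powerset.1 hL
    have c3 := card_sdiff_of_subset hL
    have c4 := card_le_card hL
    rw [← mul_sum]
    generalize s \ L = u at *
    split_ifs with hu
    · obtain ⟨a, rfl⟩ := card_eq_one.1 hu
      rw [hu, show #s - 1 = #L by omega]
      have : ({a} : Finset ι).powerset.filter (·.Nonempty) = {{a}} := by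
        ext I
        simp only [mem_filter, mem_powerset, mem_singleton, subset_singleton_iff]
        constructor
        · rintro ⟨rfl | h, h'⟩
          · simp at h'
          · exact h
        · rintro rfl; simp
      simp [this]
    · have h0 := sum_powerset_neg_one_pow_mul_add_sum_pow f u (#u - 1)
      rcases Nat.eq_zero_or_pos #u with h | h
      · rw [card_eq_zero] at h
        subst h
        simp [filter_singleton]
      · have h0 := h0 (by omega) 0
        have : ∑ I ∈ u.powerset with I.Nonempty,
            (-1) ^ (#u - #I) * (∑ i ∈ I, f i) ^ (#u - 1) =
          (-1) ^ #u * ∑ I ∈ u.powerset, (-1) ^ #I * (0 + ∑ i ∈ I, f i) ^ (#u - 1) := by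
          rw [mul_sum, sum_filter]
          refine sum_congr rfl fun I hI => ?_
          split_ifs with hne
          · have := card_le_card (mem_powerset.1 hI)
            obtain ⟨d, hd⟩ := Nat.exists_eq_add_of_le this
            rw [hd, Nat.add_sub_cancel_left, zero_add, ← mul_assoc, ← pow_add,
              show #I + d + #I = 2 * #I + d by ring, pow_add, pow_mul]
            simp
          · rw [not_nonempty_iff_eq_empty] at hne
            subst hne
            simp [show #u - 1 ≠ 0 by omega]
        rw [this, h0]; simp
  rw [sum_congr rfl inner, ← sum_filter, sum_const, nsmul_eq_mul]
  congr 2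
  rw [← card_powersetCard 1 s |>.trans (Nat.choose_one_right _)]
  refine card_nbij' (fun L => s \ L) (fun L => s \ L) ?_ ?_ ?_ ?_
  · intro L hL
    simp only [coe_filter, Set.mem_ofPred_eq, mem_powerset, mem_coe, mem_powersetCard] at hL ⊢
    exact ⟨sdiff_subset, hL.2⟩
  · intro L hL
    simp only [coe_filter, Set.mem_ofPred_eq, mem_powerset, mem_coe, mem_powersetCard] at hL ⊢
    exact ⟨sdiff_subset, by rw [Finset.sdiff_sdiff_eq_self hL.1]; exact hL.2⟩
  · intro L hL
    simp only [coe_filter, Set.mem_ofPred_eq, mem_powerset] at hL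
    exact Finset.sdiff_sdiff_eq_self hL.1
  · intro L hL
    simp only [mem_coe, mem_powersetCard] at hL
    exact Finset.sdiff_sdiff_eq_self hL.1

/-- A specialization of Hurwitz's identity, symmetric in the two parts. -/
lemma sum_ssubsets_sum_pow_mul_sum_pow {ι A : Type*} [Fintype ι] [DecidableEq ι] [CommRing A]
    (f : ι → A) (hn : 1 ≤ Fintype.card ι) :
    (∑ i, f i) * (∑ I : Finset ι, if I ≠ ∅ ∧ I ≠ univ then
      (∑ i ∈ I, f i) ^ (#I - 1) * (∑ i ∈ Iᶜ, f i) ^ (#Iᶜ - 1) else 0) =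
      2 * (Fintype.card ι - 1) * (∑ i, f i) ^ (Fintype.card ι - 1) := by
  have h := sum_powerset_nonempty_sum_pow_mul_sum_pow f univ
  rw [powerset_univ, sum_filter, card_univ] at h
  simp only [← compl_eq_univ_sdiff] at h
  have h1 : ∑ I : Finset ι, (if I ≠ ∅ ∧ I ≠ univ then
      (∑ i ∈ I, f i) ^ (#I - 1) * (∑ i ∈ Iᶜ, f i) ^ #Iᶜ else 0) =
      (Fintype.card ι - 1) * (∑ i, f i) ^ (Fintype.card ι - 1) := by
    have hne : (univ : Finset ι).Nonempty := by
      rw [← card_pos, card_univ]; omega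
    rw [sub_mul, one_mul, ← h, eq_sub_iff_add_eq,
      ← add_sum_erase _ _ (mem_univ (univ : Finset ι)),
      ← add_sum_erase _ _ (mem_univ (univ : Finset ι))]
    simp only [hne, if_true, compl_univ, card_empty, pow_zero, mul_one, card_univ, ne_eq,
      not_true_eq_false, and_false, if_false, zero_add]
    rw [add_comm]
    congr 1
    refine sum_congr rfl fun I hI => ?_
    simp [nonempty_iff_ne_empty, (mem_erase.1 hI).1]
  have h2 : ∑ I : Finset ι, (if I ≠ ∅ ∧ I ≠ univ then
      (∑ i ∈ I, f i) ^ #I * (∑ i ∈ Iᶜ, f i) ^ (#Iᶜ - 1) else 0) =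
      (Fintype.card ι - 1) * (∑ i, f i) ^ (Fintype.card ι - 1) := by
    rw [← h1]
    refine Fintype.sum_equiv (Function.Involutive.toPerm _ compl_involutive) _ _ fun I => ?_
    simp [Function.Involutive.toPerm, mul_comm, and_comm]
  rw [mul_assoc, two_mul]
  nth_rw 1 [← h1]
  rw [← h2, ← sum_add_distrib, mul_sum]
  refine sum_congr rfl fun I _ => ?_
  split_ifs with hI
  · have p1 := card_pos.2 (nonempty_iff_ne_empty.2 hI.1)
    have p2 : 0 < #Iᶜ := card_pos.2 (nonempty_iff_ne_empty.2 (by simpa using hI.2))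
    obtain ⟨k, hk⟩ := Nat.exists_eq_add_of_le' p1
    obtain ⟨l, hl⟩ := Nat.exists_eq_add_of_le' p2
    rw [← sum_add_sum_compl I, hk, hl]
    simp only [Nat.add_sub_cancel]
    ring
  · simp

lemma SX_ne_zero {n : ℕ} (hn : 1 ≤ n) : SX n ≠ 0 := by
  rw [SX, Ne, FaithfulSMul.algebraMap_eq_zero_iff]
  intro h
  have := congrArg (MvPolynomial.eval (fun i : Fin n => if i = ⟨0, hn⟩ then (1 : ℚ) else 0)) h
  simp at this

lemma emb_SX {n : ℕ} (I : Finset (Fin n)) :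
    emb I (SX #I) = algebraMap (R n) (K n) (∑ i ∈ I, X i) := by
  rw [emb, SX, IsFractionRing.lift_algebraMap]
  simp only [embRH, RingHom.comp_apply, AlgHom.toRingHom_eq_coe, RingHom.coe_coe, map_sum,
    rename_X]
  rw [← sum_coe_sort I]
  exact Fintype.sum_equiv (I.orderIsoOfFin rfl).toEquiv _ _ fun i => rfl

lemma sum_X_ne_zero {n : ℕ} {I : Finset (Fin n)} (hI : I ≠ ∅) :
    algebraMap (R n) (K n) (∑ i ∈ I, X i) ≠ 0 := by
  rw [← emb_SX]
  exact (map_ne_zero _).2 (SX_ne_zero (card_pos.2 (nonempty_iff_ne_empty.2 hI)))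

lemma Gf_zero (fuel : ℕ) :
    ∀ n, 1 ≤ n → n ≤ fuel + 1 → Gf fuel n 0 = SX n ^ ((n : ℤ) - 3) := by
  have one : ∀ fuel, Gf fuel 1 0 = SX 1 ^ (((1 : ℕ) : ℤ) - 3) := by
    intro fuel
    have : Gf fuel 1 0 = (algebraMap (R 1) (K 1) (X 0)) ^ (-2 : ℤ) := by cases fuel <;> rfl
    rw [this, SX]
    simp
  induction fuel with
  | zero =>
    intro n h1 h2
    obtain rfl : n = 1 := by omega
    exact one 0
  | succ fuel ih =>
    intro n h1 h2
    match n, h1, h2 with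
    | 1, _, _ => exact one _
    | n + 2, _, h2 =>
      have hS : SX (n + 2) ≠ 0 := SX_ne_zero (by omega)
      rw [Gf]
      simp only [zero_add, range_one, sum_singleton, mul_zero, Nat.sub_zero, pow_zero, mul_one,
        one_mul]
      set f : Fin (n + 2) → K (n + 2) := fun i => algebraMap (R (n + 2)) (K (n + 2)) (X i) with hf
      have hSf : SX (n + 2) = ∑ i, f i := by simp [SX, hf]
      have key := sum_ssubsets_sum_pow_mul_sum_pow f (by simp)
      have hterm : ∀ I : Finset (Fin (n + 2)), (if I ≠ ∅ ∧ I ≠ univ then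
          (algebraMap (R (n+2)) (K (n+2)) (∑ i ∈ I, X i))^2 *
          (algebraMap (R (n+2)) (K (n+2)) (∑ i ∈ Iᶜ, X i))^2 *
            (emb I (Gf fuel #I 0) * emb Iᶜ (Gf fuel #Iᶜ 0)) else 0) =
          if I ≠ ∅ ∧ I ≠ univ then
            (∑ i ∈ I, f i) ^ (#I - 1) * (∑ i ∈ Iᶜ, f i) ^ (#Iᶜ - 1) else 0 := by
        intro I
        split_ifs with hI
        · have hI' : Iᶜ ≠ ∅ := by simpa using hI.2
          have p1 := card_pos.2 (nonempty_iff_ne_empty.2 hI.1)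
          have p2 := card_pos.2 (nonempty_iff_ne_empty.2 hI')
          have p3 := card_add_card_compl I
          rw [Fintype.card_fin] at p3
          rw [ih _ p1 (by omega), ih _ p2 (by omega), map_zpow₀, map_zpow₀, emb_SX, emb_SX,
            mul_mul_mul_comm]
          have aux : ∀ J : Finset (Fin (n + 2)), J ≠ ∅ → 0 < #J →
              algebraMap (R (n+2)) (K (n+2)) (∑ i ∈ J, X i) ^ 2 *
              algebraMap (R (n+2)) (K (n+2)) (∑ i ∈ J, X i) ^ ((#J : ℤ) - 3) =
              (∑ i ∈ J, f i) ^ (#J - 1) := by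
            intro J hJ hJ'
            rw [← zpow_natCast, ← zpow_add₀ (sum_X_ne_zero hJ), ← zpow_natCast, map_sum]
            congr 1
            push_cast [hJ']
            omega
          rw [aux _ hI.1 p1, aux _ hI' p2]
        · rfl
      rw [sum_congr rfl fun I _ => hterm I]
      rw [← hSf, Fintype.card_fin] at key
      generalize (∑ I : Finset (Fin (n + 2)), if I ≠ ∅ ∧ I ≠ univ then
            (∑ i ∈ I, f i) ^ (#I - 1) * (∑ i ∈ Iᶜ, f i) ^ (#Iᶜ - 1) else 0) = T at *
      have hT : T = 2 * (n + 1) * SX (n + 2) ^ n := by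
        apply mul_left_cancel₀ hS
        rw [key]
        rw [show n + 2 - 1 = n + 1 by omega, pow_succ]
        push_cast
        ring
      have hdf : (Nat.doubleFactorial (n + 1) : K (n + 2)) =
          (n + 1) * (Nat.doubleFactorial (n - 1) : K (n + 2)) := by
        rcases n with _ | n
        · simp [Nat.doubleFactorial]
        · rw [Nat.doubleFactorial_add_two, Nat.add_sub_cancel]
          push_cast
          ring
      have hdf0 : (Nat.doubleFactorial (n - 1) : K (n + 2)) ≠ 0 :=
        Nat.cast_ne_zero.2 (Nat.doubleFactorial_pos _).ne'
      have hn1 : (n + 1 : K (n + 2)) ≠ 0 := by exact_mod_cast Nat.succ_ne_zero n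
      rw [hT, show (((n + 2 : ℕ) : ℤ) - 3) = (n : ℤ) - 1 by push_cast; ring,
        zpow_sub_one₀ hS, zpow_natCast]
      simp only [Nat.reduceSubDiff, Rat.cast_natCast]
      rw [hdf]
      field_simp

lemma Fnpt_zero {n : ℕ} (hn : 1 ≤ n) : Fnpt n 0 = SX n ^ ((n : ℤ) - 3) := by
  simp [Fnpt, Gnpt, Gf_zero n n hn (by omega)]

lemma polyOf_algebraMap {n : ℕ} (p : R n) : polyOf (algebraMap (R n) (K n) p) = p := by
  have h : ∃ q : R n, algebraMap (R n) (K n) q = algebraMap (R n) (K n) p := ⟨p, rfl⟩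
  rw [polyOf, dif_pos h]
  exact IsFractionRing.injective _ _ h.choose_spec

lemma polyOf_Fnpt_zero (n : ℕ) : polyOf (Fnpt (n + 3) 0) = (∑ j, X j) ^ n := by
  rw [Fnpt_zero (by omega), show (((n + 3 : ℕ) : ℤ) - 3) = (n : ℤ) by push_cast; ring,
    zpow_natCast, SX, ← map_pow, polyOf_algebraMap]

lemma binomZ_eq_choose (p : ℤ) (k : ℕ) : binomZ p k = Ring.choose (p : ℚ) k := by
  have : ∀ k, (descPochhammer ℤ k).smeval (p : ℚ) = ∏ i ∈ range k, ((p : ℚ) - i) := by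
    intro k
    induction k with
    | zero => simp
    | succ k ih =>
      rw [descPochhammer_succ_right, Polynomial.smeval_mul, ih, prod_range_succ,
        Polynomial.smeval_sub, Polynomial.smeval_X, Polynomial.smeval_natCast]
      simp
  rw [Ring.choose_eq_smul, this, binomZ, smul_eq_mul, div_eq_inv_mul]

lemma mk_binomZ_mul_pow {n : ℕ} (c : R n) (m : ℤ) :
    (PowerSeries.mk fun k => C (binomZ m k) * c ^ k) =
      PowerSeries.rescale c (PowerSeries.binomialSeries (R n) (m : ℚ)) := by
  ext1 k
  rw [PowerSeries.coeff_mk, PowerSeries.coeff_rescale, PowerSeries.binomialSeries_coeff,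
    binomZ_eq_choose, mul_comm, ← algebraMap_eq, Algebra.algebraMap_eq_smul_one]

lemma yExpAdd_add {n : ℕ} (c : R n) (p q : ℤ) :
    yExpAdd c (p + q) = yExpAdd c p * yExpAdd c q := by
  simp only [yExpAdd, mk_binomZ_mul_pow]
  rw [mul_mul_mul_comm, ← map_mul, ← map_mul, ← PowerSeries.binomialSeries_add,
    HahnSeries.single_mul_single, neg_add, mul_one, Int.cast_add]

lemma yExpAdd_natCast {n : ℕ} (c : R n) (d : ℕ) :
    yExpAdd c (d : ℤ) = (HahnSeries.single (-1 : ℤ) (1 : R n) + HahnSeries.C c) ^ d := by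
  rw [yExpAdd, mk_binomZ_mul_pow, Int.cast_natCast, PowerSeries.binomialSeries_nat, map_pow,
    map_pow, map_add, (PowerSeries.rescale c).map_one, PowerSeries.rescale_X, map_add,
    (HahnSeries.ofPowerSeries ℤ (R n)).map_one, map_mul, HahnSeries.ofPowerSeries_C,
    HahnSeries.ofPowerSeries_X]
  have : HahnSeries.single (-(d : ℤ)) (1 : R n) = HahnSeries.single (-1 : ℤ) (1 : R n) ^ d := by
    simp [HahnSeries.single_pow]
  rw [this, ← mul_pow, mul_add, mul_one, mul_left_comm, HahnSeries.single_mul_single]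
  simp

lemma LExp_eq {n : ℕ} (σ : Bool) (c : R n) (m : ℤ) :
    LExp σ c m = HahnSeries.C (if σ then 1 else if Even m then 1 else -1 : R n) *
      yExpAdd ((if σ then 1 else -1 : R n) * c) m := by
  have h1 : (1 : Lau n) = HahnSeries.C (1 : R n) := (map_one HahnSeries.C).symm
  have h2 : (-1 : Lau n) = HahnSeries.C (-1 : R n) :=
    ((map_neg HahnSeries.C 1).trans (congrArg _ (map_one _))).symm
  rw [LExp]
  congr 1
  split_ifs
  exacts [h1, h1, h2]

lemma yLau_eq (n : ℕ) (σ : Bool) :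
    yLau n σ = HahnSeries.C (if σ then 1 else -1 : R n) * HahnSeries.single (-1 : ℤ) (1 : R n) := by
  have h1 : (1 : Lau n) = HahnSeries.C (1 : R n) := (map_one HahnSeries.C).symm
  have h2 : (-1 : Lau n) = HahnSeries.C (-1 : R n) :=
    ((map_neg HahnSeries.C 1).trans (congrArg _ (map_one _))).symm
  rw [yLau]
  congr 1
  split_ifs
  exacts [h1, h2]

lemma LExp_add {n : ℕ} (σ : Bool) (c : R n) (p q : ℤ) :
    LExp σ c (p + q) = LExp σ c p * LExp σ c q := by
  rw [LExp_eq, LExp_eq, LExp_eq, yExpAdd_add, mul_mul_mul_comm, ← map_mul]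
  congr 2
  cases σ
  · by_cases hp : Even p <;> by_cases hq : Even q <;> simp [Int.even_add, hp, hq]
  · simp

lemma LExp_natCast {n : ℕ} (σ : Bool) (c : R n) (d : ℕ) :
    LExp σ c (d : ℤ) = (yLau n σ + HahnSeries.C c) ^ d := by
  have hs : (if σ then 1 else if Even (d : ℤ) then 1 else -1 : R n) =
      (if σ then 1 else -1) ^ d := by
    cases σ
    · simp [neg_one_pow_eq_ite]
    · simp
  have hs2 : (if σ then 1 else -1 : R n) * (if σ then 1 else -1) = 1 := by
    cases σ <;> simp
  rw [LExp_eq, yExpAdd_natCast, yLau_eq, hs, map_pow, ← mul_pow, mul_add, ← map_mul, ← mul_assoc,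
    hs2, one_mul]

lemma LExp_zero_left {n : ℕ} (σ : Bool) : LExp σ (0 : R n) (-2) = HahnSeries.single (2 : ℤ) 1 := by
  have : (PowerSeries.mk fun k => C (binomZ (-2) k) * (0 : R n) ^ k) = 1 := by
    rw [mk_binomZ_mul_pow]
    simp
  simp [LExp, yExpAdd, this]

lemma FExp_zero {n : ℕ} (σ : Bool) (I : Finset (Fin n)) :
    FExp σ 0 I = LExp σ (∑ i ∈ I, X i) ((#I : ℤ) - 2) := by
  rw [FExp]
  split_ifs with h0 h1
  · rw [card_eq_zero.1 h0.2]
    simp [LExp_zero_left]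
  · rw [h1.2]
    rfl
  · obtain ⟨d, hd⟩ : ∃ d, #I = d + 2 := Nat.exists_eq_add_of_le' (by omega)
    have hp : polyOf (Fnpt (#I + 1) 0) = (∑ j, X j) ^ d := by
      rw [hd]; exact polyOf_Fnpt_zero d
    rw [hp, show (#I : ℤ) - 2 = (d : ℤ) by rw [hd]; push_cast; ring, LExp_natCast, eval₂_pow,
      eval₂_sum, Fin.sum_univ_succ]
    simp only [eval₂_X, Fin.cons_zero, Fin.cons_succ]
    rw [← map_sum, ← sum_coe_sort I]
    congr 3
    exact Fintype.sum_equiv (I.orderIsoOfFin rfl).toEquiv _ _ fun i => rfl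

lemma LL_zero (n : ℕ) (a b : ℤ) :
    LL 0 n a b = ∑ I : Finset (Fin n),
      LExp true (∑ i ∈ I, X i) (a - 2 + #I) * LExp false (∑ i ∈ Iᶜ, X i) (b - 2 + #Iᶜ) := by
  simp only [LL, zero_add, range_one, sum_singleton, Nat.sub_self, FExp_zero]
  refine sum_congr rfl fun I _ => ?_
  rw [show a - 2 + (#I : ℤ) = a + (#I - 2) by ring,
    show b - 2 + (#Iᶜ : ℤ) = b + (#Iᶜ - 2) by ring, LExp_add, LExp_add, mul_assoc _ (LExp _ _ _),
    mul_mul_mul_comm]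

/-- The exponent vector of the squarefree monomial `Π_{i ∈ T} x_i`. -/
def sqfreeExp {n : ℕ} (T : Finset (Fin n)) : Fin n →₀ ℕ :=
  Finsupp.equivFunOnFinite.symm fun i => if i ∈ T then 1 else 0

lemma coeff_sqfreeExp_sum_X_mul {n : ℕ} (I T : Finset (Fin n)) (q : R n) :
    coeff (sqfreeExp T) ((∑ i ∈ I, X i) * q) =
      ∑ i ∈ T ∩ I, coeff (sqfreeExp (T.erase i)) q := by
  rw [sum_mul, coeff_sum, inter_comm, ← filter_mem_eq_inter, sum_filter]
  refine sum_congr rfl fun i _ => ?_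
  rw [coeff_X_mul']
  have hs : i ∈ (sqfreeExp T).support ↔ i ∈ T := by simp [sqfreeExp]
  simp only [hs]
  split_ifs with hi
  · congr 1
    ext j
    by_cases hj : i = j
    · subst hj; simp [sqfreeExp, hi]
    · simp [sqfreeExp, Ne.symm hj]
  · rfl

lemma coeff_sqfreeExp_sum_X_pow {n : ℕ} (J : Finset (Fin n)) (j : ℕ) :
    ∀ T ⊆ J, coeff (sqfreeExp T) ((∑ i ∈ J, X i : R n) ^ j) =
      if #T = j then (j.factorial : ℚ) else 0 := by
  induction j with
  | zero =>
    intro T _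
    have : (0 = sqfreeExp T) ↔ #T = 0 := by
      rw [card_eq_zero, eq_comm, Finsupp.ext_iff, eq_empty_iff_forall_notMem]
      simp [sqfreeExp]
    rw [pow_zero, coeff_one]
    simp [this]
  | succ j ih =>
    intro T hT
    rw [pow_succ', coeff_sqfreeExp_sum_X_mul, inter_eq_left.2 hT]
    have : ∀ i ∈ T, coeff (sqfreeExp (T.erase i)) ((∑ i ∈ J, X i : R n) ^ j) =
        if #T = j + 1 then (j.factorial : ℚ) else 0 := by
      intro i hi
      rw [ih _ ((erase_subset _ _).trans hT), card_erase_of_mem hi]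
      have := card_pos.2 ⟨i, hi⟩
      simp only [show #T - 1 = j ↔ #T = j + 1 by omega]
    rw [sum_congr rfl this, sum_const]
    split_ifs with h
    · rw [h, Nat.factorial_succ]; push_cast; simp
    · simp

lemma coeff_sqfreeExp_sum_X_pow_mul_sum_X_pow {n : ℕ} {I J : Finset (Fin n)} (hIJ : Disjoint I J)
    (i j : ℕ) : ∀ T ⊆ I ∪ J,
      coeff (sqfreeExp T) ((∑ v ∈ I, X v : R n) ^ i * (∑ v ∈ J, X v) ^ j) =
        if #(T ∩ I) = i ∧ #T = i + j then (i.factorial * j.factorial : ℚ) else 0 := by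
  induction i with
  | zero =>
    intro T hT
    by_cases h : #(T ∩ I) = 0
    · have hTJ : T ⊆ J := by
        rw [card_eq_zero, ← disjoint_iff_inter_eq_empty] at h
        exact h.left_le_of_le_sup_left hT
      simp [coeff_sqfreeExp_sum_X_pow J j T hTJ, h]
    · have : coeff (sqfreeExp T) ((∑ v ∈ J, X v : R n) ^ j) = 0 := by
        clear hT
        induction j generalizing T with
        | zero =>
          rw [pow_zero, coeff_one, if_neg]
          rintro h'
          apply h
          have : T = ∅ := by
            rw [eq_empty_iff_forall_notMem]
            intro i
            have := DFunLike.congr_fun h' i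
            simpa [sqfreeExp] using this
          simp [this]
        | succ j ih =>
          rw [pow_succ', coeff_sqfreeExp_sum_X_mul]
          refine sum_eq_zero fun v hv => ih _ ?_
          have : v ∉ I := fun hvI => disjoint_left.1 hIJ hvI (mem_inter.1 hv).2
          rwa [erase_inter, erase_eq_of_notMem (by simp [this])]
      simp [this, h]
  | succ i ih =>
    intro T hT
    rw [pow_succ', mul_assoc, coeff_sqfreeExp_sum_X_mul]
    have : ∀ v ∈ T ∩ I, coeff (sqfreeExp (T.erase v))
        ((∑ v ∈ I, X v : R n) ^ i * (∑ v ∈ J, X v) ^ j) =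
        if #(T ∩ I) = i + 1 ∧ #T = i + 1 + j then (i.factorial * j.factorial : ℚ) else 0 := by
      intro v hv
      have hvT := (mem_inter.1 hv).1
      rw [ih _ ((erase_subset _ _).trans hT), erase_inter, card_erase_of_mem hvT,
        card_erase_of_mem hv]
      have h1 := card_pos.2 ⟨v, hv⟩
      have h2 := card_pos.2 ⟨v, hvT⟩
      simp only [show (#(T ∩ I) - 1 = i ∧ #T - 1 = i + j) ↔
        (#(T ∩ I) = i + 1 ∧ #T = i + 1 + j) by omega]
    rw [sum_congr rfl this, sum_const]
    split_ifs with h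
    · rw [h.1, Nat.factorial_succ]; push_cast; simp; ring
    · simp

lemma coeffL_LExp_mul_LExp {n : ℕ} (a b : ℤ) (I : Finset (Fin n)) :
    coeffL (LExp true (∑ i ∈ I, X i) (a - 2 + #I) * LExp false (∑ i ∈ Iᶜ, X i) (b - 2 + #Iᶜ))
      (a + b - 4) (fun _ => 1) =
    (-1) ^ b * ((#I).factorial * (#Iᶜ).factorial) *
      (binomZ (a - 2 + #I) #I * binomZ (b - 2 + #Iᶜ) #Iᶜ) := by
  have hcard : #I + #Iᶜ = n := by simp [card_add_card_compl]
  have hsq : (Finsupp.equivFunOnFinite.symm fun _ => 1 : Fin n →₀ ℕ) = sqfreeExp univ := by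
    simp [sqfreeExp]
  rw [coeffL, hsq, LExp_eq, LExp_eq, yExpAdd, yExpAdd, mul_mul_mul_comm, ← map_mul,
    mul_mul_mul_comm, HahnSeries.single_mul_single, ← map_mul, HahnSeries.C_apply,
    HahnSeries.coeff_single_zero_mul, HahnSeries.coeff_single_mul,
    show -(a + b - 4) - (-(a - 2 + #I) + -(b - 2 + (#Iᶜ : ℤ))) = (n : ℤ) by
      rw [show (n : ℤ) = #I + #Iᶜ by exact_mod_cast hcard.symm]; ring,
    HahnSeries.ofPowerSeries_apply_coeff, PowerSeries.coeff_mul, mul_one, one_mul,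
    mul_sum, coeff_sum]
  have hsgn : (if Even (b - 2 + (#Iᶜ : ℤ)) then 1 else -1 : R n) =
      C ((-1 : ℚ) ^ b * (-1) ^ #Iᶜ) := by
    rw [← zpow_natCast, ← zpow_add₀ (by norm_num)]
    have : Even (b - 2 + (#Iᶜ : ℤ)) ↔ Even (b + #Iᶜ) := by
      rw [show b - 2 + (#Iᶜ : ℤ) = b + #Iᶜ - 2 by ring, Int.even_sub]
      simp
    simp only [this]
    split_ifs with h
    · simp [h.neg_one_zpow]
    · simp [(Int.not_even_iff_odd.1 h).neg_one_zpow]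
  have hterm : ∀ p ∈ antidiagonal n, coeff (sqfreeExp univ)
      ((if true then 1 else if Even (a - 2 + (#I : ℤ)) then 1 else -1 : R n) *
        (if false then 1 else if Even (b - 2 + (#Iᶜ : ℤ)) then 1 else -1 : R n) *
      (PowerSeries.coeff p.1 (PowerSeries.mk fun k =>
          C (binomZ (a - 2 + #I) k) * ((if true then 1 else -1 : R n) * ∑ i ∈ I, X i) ^ k) *
       PowerSeries.coeff p.2 (PowerSeries.mk fun k =>
          C (binomZ (b - 2 + #Iᶜ) k) * ((if false then 1 else -1 : R n) * ∑ i ∈ Iᶜ, X i) ^ k))) =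
      if p = (#I, #Iᶜ) then (-1) ^ b * ((#I).factorial * (#Iᶜ).factorial) *
      (binomZ (a - 2 + #I) #I * binomZ (b - 2 + #Iᶜ) #Iᶜ) else 0 := by
    rintro ⟨i, j⟩ hij
    rw [HasAntidiagonal.mem_antidiagonal] at hij
    simp only [PowerSeries.coeff_mk, if_true, Bool.false_eq_true, if_false, hsgn, one_mul, mul_pow]
    have : C ((-1 : ℚ) ^ b * (-1) ^ #Iᶜ) * (C (binomZ (a - 2 + #I) i) * (∑ i ∈ I, X i) ^ i *
        (C (binomZ (b - 2 + #Iᶜ) j) * ((-1) ^ j * (∑ i ∈ Iᶜ, X i) ^ j))) =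
        C ((-1 : ℚ) ^ b * (-1) ^ #Iᶜ * (-1) ^ j * binomZ (a - 2 + #I) i * binomZ (b - 2 + #Iᶜ) j) *
          ((∑ i ∈ I, X i : R n) ^ i * (∑ i ∈ Iᶜ, X i) ^ j) := by
      simp only [map_mul, map_pow, map_neg, map_one]
      ring
    rw [this, coeff_C_mul, coeff_sqfreeExp_sum_X_pow_mul_sum_X_pow disjoint_compl_right i j univ
      (by simp), univ_inter, card_univ, Fintype.card_fin]
    by_cases h : #I = i
    · obtain rfl : #Iᶜ = j := by omega
      subst h
      have h1 : ((-1 : ℚ) ^ #Iᶜ) * (-1) ^ #Iᶜ = 1 := by rw [← mul_pow]; simp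
      simp only [hcard, and_self, if_true]
      linear_combination ((-1) ^ b * ((#I).factorial * (#Iᶜ).factorial) *
      (binomZ (a - 2 + #I) #I * binomZ (b - 2 + #Iᶜ) #Iᶜ)) * h1
    · have h' : ¬ i = #I := fun h' => h h'.symm
      simp [h, h']
  refine (sum_congr rfl hterm).trans ?_
  rw [sum_ite_eq', if_pos (HasAntidiagonal.mem_antidiagonal.2 hcard)]

/-- Vandermonde's identity, with negated upper arguments. -/
lemma sum_antidiagonal_choose_add_sub_one (p q : ℚ) (n : ℕ) :
    ∑ k ∈ antidiagonal n, Ring.choose (p + k.1 - 1) k.1 * Ring.choose (q + k.2 - 1) k.2 =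
      Ring.choose (p + q + n - 1) n := by
  have h := Ring.add_choose_eq n (Commute.all (-p) (-q))
  rw [← neg_add, Ring.choose_neg] at h
  have h2 : ∀ k ∈ antidiagonal n, Ring.choose (-p) k.1 * Ring.choose (-q) k.2 =
      Int.negOnePow n • (Ring.choose (p + k.1 - 1) k.1 * Ring.choose (q + k.2 - 1) k.2) := by
    intro k hk
    rw [Ring.choose_neg, Ring.choose_neg, smul_mul_smul_comm, ← Int.negOnePow_add,
      ← HasAntidiagonal.mem_antidiagonal.1 hk]
    simp
  rw [sum_congr rfl h2, ← smul_sum] at h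
  exact (smul_left_cancel _ h).symm

lemma factorial_mul_binomZ (p : ℕ) (n : ℕ) :
    (n.factorial : ℚ) * binomZ ((p : ℤ) + n) n = ((p + n).factorial : ℚ) / p.factorial := by
  have : ((p : ℤ) + n : ℤ) = ((p + n : ℕ) : ℤ) := by push_cast; ring
  rw [binomZ_eq_choose, this, Int.cast_natCast, Ring.choose_natCast,
    eq_div_iff (Nat.cast_ne_zero.2 (Nat.factorial_ne_zero _))]
  have := Nat.add_choose_mul_factorial_mul_factorial p n
  rw [← this]
  push_cast
  ring

/-- Lemma 4.3 (ii): the coefficient of `y^{a+b−4} x_1⋯x_n` in `L_0^{a,b}(y,x)` equals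
`(−1)^b n! C(a+b+n−3, n)`, which is `(−1)^b (a+b+n−3)!/(a+b−3)!` when `a+b ≥ 3`. -/
theorem lemma_4_3_ii (a b : ℤ) (n : ℕ) (hn : 1 ≤ n) :
    (coeffL (LL 0 n a b) (a + b - 4) (fun _ => 1)
        = (-1 : ℚ)^b * (n.factorial : ℚ) * binomZ (a + b + n - 3) n) ∧
    (3 ≤ a + b →
      (-1 : ℚ)^b * (n.factorial : ℚ) * binomZ (a + b + n - 3) n
        = (-1 : ℚ)^b * ((a + b + n - 3).toNat.factorial : ℚ) /
            ((a + b - 3).toNat.factorial : ℚ)) := by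
  constructor
  · have hlin : coeffL (LL 0 n a b) (a + b - 4) (fun _ => 1) = ∑ I : Finset (Fin n),
        coeffL (LExp true (∑ i ∈ I, X i) (a - 2 + #I) *
          LExp false (∑ i ∈ Iᶜ, X i) (b - 2 + #Iᶜ)) (a + b - 4) (fun _ => 1) := by
      simp only [coeffL, LL_zero, HahnSeries.coeff_sum, coeff_sum]
    have hv := sum_antidiagonal_choose_add_sub_one (a - 1) (b - 1) n
    rw [Nat.sum_antidiagonal_eq_sum_range_succ_mk] at hv
    rw [hlin, sum_congr rfl fun I _ => coeffL_LExp_mul_LExp a b I, ← powerset_univ]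
    simp only [card_compl, Fintype.card_fin]
    rw [sum_powerset_apply_card (fun k => (-1 : ℚ) ^ b * (k.factorial * (n - k).factorial) *
      (binomZ (a - 2 + k) k * binomZ (b - 2 + (n - k : ℕ)) (n - k))), card_univ, Fintype.card_fin,
      binomZ_eq_choose, show ((a + b + n - 3 : ℤ) : ℚ) = (a - 1) + (b - 1) + n - 1 by
        push_cast; ring, ← hv, mul_sum]
    refine sum_congr rfl fun k hk => ?_
    have hk : k ≤ n := by have := mem_range.1 hk; omega
    rw [binomZ_eq_choose, binomZ_eq_choose, ← Nat.choose_mul_factorial_mul_factorial hk]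
    have h1 : ((a - 2 + k : ℤ) : ℚ) = a - 1 + k - 1 := by push_cast; ring
    have h2 : ((b - 2 + (n - k : ℕ) : ℤ) : ℚ) = b - 1 + (n - k : ℕ) - 1 := by
      rw [Int.cast_add, Int.cast_natCast]; push_cast; ring
    rw [h1, h2, nsmul_eq_mul]
    push_cast
    ring
  · intro hab
    obtain ⟨p, hp⟩ := Int.eq_ofNat_of_zero_le (sub_nonneg.2 hab)
    rw [show a + b + n - 3 = (p : ℤ) + n by omega, hp, mul_assoc, factorial_mul_binomZ,
      mul_div_assoc, Int.toNat_natCast, ← Nat.cast_add, Int.toNat_natCast]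

end
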